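/- arXiv:math-ph/0604024 — 5 statements merged into one kernel-verified Lean document; each statement's English description precedes it below -/
import Mathlib

section
/- For all twisted series $A, B$ with support bounded above over $(R,\sigma)$ with $R$ commutative, the residue of the commutator lies in the image of $\sigma - \mathrm{id}$: $\mathrm{res}(AB - BA) \in (\sigma - \mathrm{id})(R)$ (the image is an additive subgroup of $R$). Hence the trace $\mathrm{tr}\,A = \int \mathrm{res}\,A$, which kills the image of $\sigma - \mathrm{id}$, vanishes on commutators, and the inner product $\langle A,B\rangle = \mathrm{tr}(AB)$ is invariant: $\langle [L,X], Y\rangle = \langle X, [Y,L]\rangle$ modulo $(\sigma-\mathrm{id})(R)$ at the level of residues. -/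
/-!
STATEMENT 9.  For twisted difference series `A, B` (over a commutative ring `R` with
ring automorphism `σ`, product `(AB)_k = ∑_{i+j=k} a_i σ^i(b_j)`) with support
bounded above, the residue of the commutator lies in the image of `σ - id`:
`res(AB - BA) ∈ (σ - id)(R)`.  Hence the trace `tr A = ∫ res A`, which kills
`(σ - id)(R)`, vanishes on commutators, and the inner product `⟨A,B⟩ = tr(AB)` is
invariant: at the level of residues, `res([L,X] Y) - res(X [Y,L]) ∈ (σ - id)(R)`.
-/

open scoped BigOperators

namespace Toda

variable {R : Type*} [CommRing R]

/-- Twisted product of series `A = ∑ a_k Λ^k`, `B = ∑ b_k Λ^k` over `(R,σ)`: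
`(A B)_k = ∑_{i+j=k} a_i σ^i(b_j)` (a finite sum when supports are bounded). -/
noncomputable def tmul (σ : R ≃+* R) (a b : ℤ → R) : ℤ → R :=
  fun k => ∑ᶠ i : ℤ, a i * (σ ^ i) (b (k - i))

/-- Commutator `[A,B] = AB - BA`. -/
noncomputable def tcomm (σ : R ≃+* R) (a b : ℤ → R) : ℤ → R :=
  tmul σ a b - tmul σ b a

/-- `A₊`: the part of nonnegative degree. -/
def tpos (a : ℤ → R) : ℤ → R := fun k => if 0 ≤ k then a k else 0

/-- `A₋`: the part of negative degree. -/
def tneg (a : ℤ → R) : ℤ → R := fun k => if k < 0 then a k else 0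

/-- The part of degree `≤ 0`. -/
def tle0 (a : ℤ → R) : ℤ → R := fun k => if k ≤ 0 then a k else 0

/-- The part of degree `> 0`. -/
def tgt0 (a : ℤ → R) : ℤ → R := fun k => if 0 < k then a k else 0

/-- The monomial `Λ^m` (coefficient `1` in degree `m`). -/
def tunit (m : ℤ) : ℤ → R := fun k => if k = m then 1 else 0

/-- `n`-th power for the twisted product. -/
noncomputable def tnpow (σ : R ≃+* R) (a : ℤ → R) : ℕ → (ℤ → R)
  | 0 => tunit 0
  | n + 1 => tmul σ a (tnpow σ a n)

/-- The residue `res A = a_0`. -/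
def tres (a : ℤ → R) : R := a 0

/-- `A` has support bounded above. -/
def SuppBddAbove (a : ℤ → R) : Prop := ∃ B : ℤ, ∀ k : ℤ, B < k → a k = 0

end Toda

open Toda

namespace Toda

variable {R : Type*} [CommRing R]

theorem mul_apply_eq_zero_of_notMem_Icc (σ : R ≃+* R) {a b : ℤ → R} {A B : ℤ}
    (ha : ∀ k, A < k → a k = 0) (hb : ∀ k, B < k → b k = 0) {k i : ℤ}
    (hi : i ∉ Set.Icc (k - B) A) : a i * (σ ^ i) (b (k - i)) = 0 := by
  rw [Set.mem_Icc, not_and_or, not_le, not_le] at hi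
  rcases hi with hi | hi
  · rw [hb (k - i) (by lia), map_zero, mul_zero]
  · rw [ha i hi, zero_mul]

theorem finite_support_tmul_summand (σ : R ≃+* R) {a b : ℤ → R}
    (ha : SuppBddAbove a) (hb : SuppBddAbove b) (k : ℤ) :
    (Function.support fun i : ℤ => a i * (σ ^ i) (b (k - i))).Finite := by
  obtain ⟨A, ha⟩ := ha
  obtain ⟨B, hb⟩ := hb
  refine (Set.finite_Icc (k - B) A).subset fun i hi => ?_
  by_contra h
  exact hi (mul_apply_eq_zero_of_notMem_Icc σ ha hb h)

/-- The twisted product as a sum over any interval containing a translate of the support. -/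
theorem tmul_eq_sum_Icc (σ : R ≃+* R) {a b : ℤ → R} {A B : ℤ}
    (ha : ∀ k, A < k → a k = 0) (hb : ∀ k, B < k → b k = 0) {k p q : ℤ} (s : ℤ)
    (hp : p - s ≤ k - B) (hq : A ≤ q - s) :
    tmul σ a b k = ∑ i ∈ Finset.Icc p q, a (i - s) * (σ ^ (i - s)) (b (k - (i - s))) := by
  rw [tmul, ← finsum_comp_equiv (Equiv.subRight s)]
  refine finsum_eq_sum_of_support_subset _ fun i hi => ?_
  by_contra h
  refine hi (mul_apply_eq_zero_of_notMem_Icc σ ha hb fun h' => h ?_)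
  simp only [Equiv.subRight_apply, Set.mem_Icc, Finset.coe_Icc] at h' ⊢
  lia

theorem tmul_apply_eq_zero (σ : R ≃+* R) {a b : ℤ → R} {A B : ℤ}
    (ha : ∀ k, A < k → a k = 0) (hb : ∀ k, B < k → b k = 0) (k : ℤ) (hk : A + B < k) :
    tmul σ a b k = 0 := by
  refine finsum_eq_zero_of_forall_eq_zero fun i =>
    mul_apply_eq_zero_of_notMem_Icc σ ha hb fun h => ?_
  rw [Set.mem_Icc] at h
  lia

theorem SuppBddAbove.tmul (σ : R ≃+* R) {a b : ℤ → R} (ha : SuppBddAbove a)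
    (hb : SuppBddAbove b) : SuppBddAbove (tmul σ a b) := by
  obtain ⟨A, ha⟩ := ha
  obtain ⟨B, hb⟩ := hb
  exact ⟨A + B, tmul_apply_eq_zero σ ha hb⟩

theorem tmul_assoc (σ : R ≃+* R) {a b c : ℤ → R} (ha : SuppBddAbove a)
    (hb : SuppBddAbove b) (hc : SuppBddAbove c) :
    tmul σ (tmul σ a b) c = tmul σ a (tmul σ b c) := by
  obtain ⟨A, ha⟩ := ha
  obtain ⟨B, hb⟩ := hb
  obtain ⟨C, hc⟩ := hc
  funext k
  rw [tmul_eq_sum_Icc σ (tmul_apply_eq_zero σ ha hb) hc (p := k - C) (q := A + B) 0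
      (by lia) (by lia),
    tmul_eq_sum_Icc σ ha (tmul_apply_eq_zero σ hb hc) (p := k - C - B) (q := A) 0
      (by lia) (by lia)]
  simp only [sub_zero]
  have hl : ∀ i ∈ Finset.Icc (k - C) (A + B), tmul σ a b i * (σ ^ i) (c (k - i)) =
      ∑ j ∈ Finset.Icc (k - C - B) A, a j * (σ ^ j) (b (i - j)) * (σ ^ i) (c (k - i)) := by
    intro i hi
    rw [Finset.mem_Icc] at hi
    rw [tmul_eq_sum_Icc σ ha hb (p := k - C - B) (q := A) 0 (by lia) (by lia),
      Finset.sum_mul]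
    simp only [sub_zero]
  have hr : ∀ j ∈ Finset.Icc (k - C - B) A, a j * (σ ^ j) (tmul σ b c (k - j)) =
      ∑ i ∈ Finset.Icc (k - C) (A + B), a j * (σ ^ j) (b (i - j)) * (σ ^ i) (c (k - i)) := by
    intro j hj
    rw [Finset.mem_Icc] at hj
    rw [tmul_eq_sum_Icc σ hb hc (p := k - C) (q := A + B) j (by lia) (by lia),
      map_sum, Finset.mul_sum]
    refine Finset.sum_congr rfl fun i _ => ?_
    rw [map_mul, ← RingAut.mul_apply, ← zpow_add, add_sub_cancel, sub_sub_sub_cancel_right,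
      mul_assoc]
  rw [Finset.sum_congr rfl hl, Finset.sum_congr rfl hr, Finset.sum_comm]

theorem sub_tmul (σ : R ≃+* R) {a a' b : ℤ → R} (ha : SuppBddAbove a)
    (ha' : SuppBddAbove a') (hb : SuppBddAbove b) :
    tmul σ (a - a') b = tmul σ a b - tmul σ a' b := by
  funext k
  simp only [tmul, Pi.sub_apply, sub_mul]
  exact finsum_sub_distrib (finite_support_tmul_summand σ ha hb k)
    (finite_support_tmul_summand σ ha' hb k)

theorem tmul_sub (σ : R ≃+* R) {a b b' : ℤ → R} (ha : SuppBddAbove a)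
    (hb : SuppBddAbove b) (hb' : SuppBddAbove b') :
    tmul σ a (b - b') = tmul σ a b - tmul σ a b' := by
  funext k
  simp only [tmul, Pi.sub_apply, map_sub, mul_sub]
  exact finsum_sub_distrib (finite_support_tmul_summand σ ha hb k)
    (finite_support_tmul_summand σ ha hb' k)

/-- The image of `σ - id` as an additive subgroup. -/
def subIdRange (σ : R ≃+* R) : AddSubgroup R :=
  (σ.toAddMonoidHom - AddMonoidHom.id R).range

theorem mem_subIdRange {σ : R ≃+* R} {x : R} : x ∈ subIdRange σ ↔ ∃ r, x = σ r - r := by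
  simp [subIdRange, AddMonoidHom.mem_range, eq_comm]

theorem zpow_sub_self_mem_subIdRange (σ : R ≃+* R) (n : ℤ) (x : R) :
    (σ ^ n) x - x ∈ subIdRange σ := by
  have step (m : ℤ) : (σ ^ (m + 1)) x - (σ ^ m) x ∈ subIdRange σ :=
    mem_subIdRange.2 ⟨(σ ^ m) x, by rw [add_comm, zpow_add, zpow_one, RingAut.mul_apply]⟩
  induction n using Int.induction_on with
  | zero => simp
  | succ m ih => simpa using add_mem (step m) ih
  | pred m ih => simpa using sub_mem ih (step (-m - 1))

theorem tres_tcomm_mem_subIdRange (σ : R ≃+* R) {a b : ℤ → R} (ha : SuppBddAbove a)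
    (hb : SuppBddAbove b) : tres (tcomm σ a b) ∈ subIdRange σ := by
  have hba : tmul σ b a 0 = ∑ᶠ i : ℤ, b (-i) * (σ ^ (-i)) (a (0 - -i)) :=
    (finsum_comp_equiv (Equiv.neg ℤ)).symm
  have hfin : (Function.support fun i : ℤ => b (-i) * (σ ^ (-i)) (a (0 - -i))).Finite :=
    (finite_support_tmul_summand σ hb ha 0).preimage neg_injective.injOn
  rw [tres, tcomm, Pi.sub_apply, hba, tmul,
    ← finsum_sub_distrib (finite_support_tmul_summand σ ha hb 0) hfin]
  refine finsum_induction (· ∈ subIdRange σ) (zero_mem _) (fun _ _ => add_mem) fun i => ?_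
  convert zpow_sub_self_mem_subIdRange σ i (b (-i) * (σ ^ (-i)) (a i)) using 2
  · rw [map_mul, ← RingAut.mul_apply, ← zpow_add, add_neg_cancel, zpow_zero,
      RingAut.one_apply, zero_sub, mul_comm]
  · rw [zero_sub, neg_neg]

end Toda

/-- **Residue of a commutator lies in `(σ - id)(R)`**, and the induced invariance of
the trace form: `res([L,X]·Y) ≡ res(X·[Y,L])` modulo `(σ - id)(R)`. -/
theorem res_comm_in_image {R : Type*} [CommRing R] (σ : R ≃+* R) :
    (∀ a b : ℤ → R, SuppBddAbove a → SuppBddAbove b →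
      ∃ r : R, tres (tcomm σ a b) = σ r - r) ∧
    (∀ L X Y : ℤ → R, SuppBddAbove L → SuppBddAbove X → SuppBddAbove Y →
      ∃ r : R, tres (tmul σ (tcomm σ L X) Y) - tres (tmul σ X (tcomm σ Y L))
        = σ r - r) := by
  refine ⟨fun a b ha hb => mem_subIdRange.1 (tres_tcomm_mem_subIdRange σ ha hb),
    fun L X Y hL hX hY => mem_subIdRange.1 ?_⟩
  convert tres_tcomm_mem_subIdRange σ hL (hX.tmul σ hY) using 1
  simp only [tres, tcomm]
  rw [sub_tmul σ (hL.tmul σ hX) (hX.tmul σ hL) hY, tmul_sub σ hX (hY.tmul σ hL) (hL.tmul σ hY),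
    tmul_assoc σ hL hX hY, tmul_assoc σ hX hL hY, tmul_assoc σ hX hY hL]
  simp only [Pi.sub_apply]
  ring
end

section
/- Fix integers $N \ge 1$, $M \ge 1$ and let $L = \Lambda^N + u_{N-1}\Lambda^{N-1} + \cdots + u_{-M}\Lambda^{-M}$ be a twisted series supported in degrees $-M,\dots,N$ with top coefficient $1$. Let $X$ be a twisted series with support bounded above such that $[X, L] = 0$. Then $[X_+, L] = -[X_-, L]$, this operator has all coefficients zero outside degrees $-M \le k \le N-1$, and consequently $P_1(X) := [X_+, L]_{\le 0} - [X_-, L]_{> 0} = [X_+, L]$, where $(\cdot)_{\le 0}$ and $(\cdot)_{>0}$ denote the parts of degree $\le 0$ and $> 0$. In particular the Lax flow $L_t = [X_+,L]$ preserves the space of operators of the form $\Lambda^N + u_{N-1}\Lambda^{N-1} + \cdots + u_{-M}\Lambda^{-M}$. -/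
/-!
STATEMENT 11.  Fix `N, M ≥ 1` and let `L = Λ^N + u_{N-1}Λ^{N-1} + ⋯ + u_{-M}Λ^{-M}`
be a twisted series supported in degrees `-M,…,N` with top coefficient `1`.  If `X`
has support bounded above and `[X,L] = 0`, then `[X₊,L] = -[X₋,L]`, this operator
vanishes outside degrees `-M ≤ k ≤ N-1`, and consequently
`P₁(X) := [X₊,L]_{≤0} - [X₋,L]_{>0} = [X₊,L]`; in particular the Lax flow
`L_t = [X₊,L]` preserves the space of operators of the given form.
-/

open scoped BigOperators

open Toda

namespace Toda

variable {R : Type*} [CommRing R]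

/-- The positive and negative parts add up to the whole series. -/
theorem tpos_add_tneg (a : ℤ → R) : tpos a + tneg a = a := by
  funext k
  by_cases hk : 0 ≤ k
  · simp [tpos, tneg, hk, not_lt.mpr hk]
  · simp [tpos, tneg, hk, not_le.mp hk]

/-- Left factors distribute over a right factor of finite support. -/
theorem tmul_add_left (σ : R ≃+* R) (a a' b : ℤ → R) (hb : b.support.Finite) :
    tmul σ (a + a') b = tmul σ a b + tmul σ a' b := by
  funext k
  have hfin : ∀ c : ℤ → R,
      (Function.support fun i : ℤ => c i * (σ ^ i) (b (k - i))).Finite := by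
    intro c
    refine (hb.preimage (sub_right_injective (b := k)).injOn).subset fun i hi h => hi ?_
    simp [h]
  simp only [tmul, Pi.add_apply, add_mul]
  exact finsum_add_distrib (hfin a) (hfin a')

/-- Right factors distribute over a left factor of finite support. -/
theorem tmul_add_right (σ : R ≃+* R) (a b b' : ℤ → R) (ha : a.support.Finite) :
    tmul σ a (b + b') = tmul σ a b + tmul σ a b' := by
  funext k
  have hfin : ∀ c : ℤ → R,
      (Function.support fun i : ℤ => a i * (σ ^ i) (c (k - i))).Finite := by
    intro c
    refine ha.subset fun i hi h => hi ?_
    simp [h]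
  simp only [tmul, Pi.add_apply, map_add, mul_add]
  exact finsum_add_distrib (hfin b) (hfin b')

/-- The commutator with a series of finite support is additive. -/
theorem tcomm_add_left (σ : R ≃+* R) (a a' b : ℤ → R) (hb : b.support.Finite) :
    tcomm σ (a + a') b = tcomm σ a b + tcomm σ a' b := by
  simp only [tcomm, tmul_add_left σ a a' b hb, tmul_add_right σ b a a' hb]
  abel

/-- A coefficient of a product vanishes when no pair of degrees contributes to it. -/
theorem tmul_apply_eq_zero_s11 (σ : R ≃+* R) {a b : ℤ → R} {k : ℤ}
    (h : ∀ i j : ℤ, i + j = k → a i = 0 ∨ b j = 0) : tmul σ a b k = 0 := by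
  refine finsum_eq_zero_of_forall_eq_zero fun i => ?_
  rcases h i (k - i) (by ring) with h | h <;> simp [h]

/-- A coefficient of a commutator vanishes when no pair of degrees contributes to it. -/
theorem tcomm_apply_eq_zero (σ : R ≃+* R) {a b : ℤ → R} {k : ℤ}
    (h : ∀ i j : ℤ, i + j = k → a i = 0 ∨ b j = 0) : tcomm σ a b k = 0 := by
  rw [tcomm, Pi.sub_apply, tmul_apply_eq_zero_s11 σ h,
    tmul_apply_eq_zero_s11 σ fun i j hij => (h j i (by rwa [add_comm])).symm, sub_zero]

end Toda

/-- **The first Hamiltonian operator and well-definedness of the Lax flows**: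
for `L = Λ^N + u_{N-1}Λ^{N-1} + ⋯ + u_{-M}Λ^{-M}` and `X` bounded above with
`[X,L] = 0`, one has `[X₊,L] = -[X₋,L]`, it is supported in degrees
`-M ≤ k ≤ N-1`, and `P₁(X) = [X₊,L]_{≤0} - [X₋,L]_{>0} = [X₊,L]`. -/
theorem first_hamiltonian_operator {R : Type*} [CommRing R] (σ : R ≃+* R)
    (N M : ℕ) (hN : 1 ≤ N) (hM : 1 ≤ M) (L X : ℤ → R)
    (hLtop : L (N : ℤ) = 1)
    (hLhigh : ∀ k : ℤ, (N : ℤ) < k → L k = 0)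
    (hLlow : ∀ k : ℤ, k < -(M : ℤ) → L k = 0)
    (hX : SuppBddAbove X)
    (hcomm : tcomm σ X L = 0) :
    tcomm σ (tpos X) L = -(tcomm σ (tneg X) L) ∧
    (∀ k : ℤ, k < -(M : ℤ) ∨ (N : ℤ) - 1 < k → tcomm σ (tpos X) L k = 0) ∧
    tle0 (tcomm σ (tpos X) L) - tgt0 (tcomm σ (tneg X) L)
      = tcomm σ (tpos X) L := by
  have hL : L.support.Finite := by
    refine (Set.finite_Icc (-(M : ℤ)) N).subset fun k hk => ?_
    by_contra hk'
    rw [Set.mem_Icc, not_and_or, not_le, not_le] at hk'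
    exact hk (hk'.elim (hLlow k) (hLhigh k))
  have hneg : tcomm σ (tpos X) L = -(tcomm σ (tneg X) L) := by
    rw [eq_neg_iff_add_eq_zero, ← tcomm_add_left σ _ _ L hL, tpos_add_tneg, hcomm]
  refine ⟨hneg, ?_, ?_⟩
  · rintro k (hk | hk)
    · refine tcomm_apply_eq_zero σ fun i j hij => ?_
      by_cases hi : 0 ≤ i
      · exact Or.inr (hLlow j (by lia))
      · exact Or.inl (if_neg hi)
    · rw [hneg, Pi.neg_apply, neg_eq_zero]
      refine tcomm_apply_eq_zero σ fun i j hij => ?_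
      by_cases hi : i < 0
      · exact Or.inr (hLhigh j (by lia))
      · exact Or.inl (if_neg hi)
  · funext k
    by_cases hk : k ≤ 0
    · simp [tle0, tgt0, hk, not_lt.mpr hk]
    · simp [tle0, tgt0, hk, not_le.mp hk, hneg]
end

section
/- Let $B_1, B_2$ be twisted series with support bounded above over $(R,\sigma)$ with $R$ commutative, and suppose $[B_1, B_2] = 0$. Then $\mathrm{res}\,[(B_1)_-, B_2] = \mathrm{res}\,[(B_2)_-, B_1]$. (This residue symmetry is the algebraic core of the tau-symmetry $\partial h_{\alpha,p-1}/\partial t^{\beta,q} = \partial h_{\beta,q-1}/\partial t^{\alpha,p}$ of the Hamiltonian densities of the extended bigraded Toda hierarchy.) -/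
/-!
STATEMENT 13.  For twisted difference series `B₁, B₂` (over a commutative ring `R`
with ring automorphism `σ`) with support bounded above and `[B₁, B₂] = 0`, one has
`res [(B₁)₋, B₂] = res [(B₂)₋, B₁]` — the algebraic core of the tau-symmetry of the
Hamiltonian densities of the extended bigraded Toda hierarchy.
-/

open scoped BigOperators

open Toda

theorem Toda.tres_tmul_eq_sum {R : Type*} [CommRing R] (σ : R ≃+* R) {a b : ℤ → R} {N : ℤ}
    (ha : ∀ k, N < k → a k = 0) (hb : ∀ k, N < k → b k = 0) :
    tres (tmul σ a b) = ∑ i ∈ Finset.Icc (-N) N, a i * (σ ^ i) (b (-i)) := by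
  simp only [tres, tmul, zero_sub]
  refine finsum_eq_sum_of_support_subset _ fun i hi => ?_
  rw [Finset.coe_Icc, Set.mem_Icc]
  by_contra h
  apply hi
  rcases lt_or_ge N i with hN | hN
  · simp [ha i hN]
  · simp [hb (-i) (by omega)]

theorem Toda.tneg_eq_zero_of_lt {R : Type*} [CommRing R] {a : ℤ → R} {N : ℤ}
    (ha : ∀ k, N < k → a k = 0) (k : ℤ) (hk : N < k) : tneg a k = 0 := by
  simp [tneg, ha k hk]

/-- **Tau-symmetry residue identity**: if `[B₁,B₂] = 0` then
`res [(B₁)₋, B₂] = res [(B₂)₋, B₁]`. -/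
theorem tau_symmetry_core {R : Type*} [CommRing R] (σ : R ≃+* R) (b₁ b₂ : ℤ → R)
    (h₁ : SuppBddAbove b₁) (h₂ : SuppBddAbove b₂)
    (hcomm : tcomm σ b₁ b₂ = 0) :
    tres (tcomm σ (tneg b₁) b₂) = tres (tcomm σ (tneg b₂) b₁) := by
  obtain ⟨N₁, hN₁⟩ := h₁
  obtain ⟨N₂, hN₂⟩ := h₂
  have h₁' : ∀ k, max N₁ N₂ < k → b₁ k = 0 := fun k hk => hN₁ k (by omega)
  have h₂' : ∀ k, max N₁ N₂ < k → b₂ k = 0 := fun k hk => hN₂ k (by omega)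
  have hres : tres (tmul σ b₁ b₂) - tres (tmul σ b₂ b₁) = 0 := congrFun hcomm 0
  change tres (tmul σ (tneg b₁) b₂) - tres (tmul σ b₂ (tneg b₁)) =
    tres (tmul σ (tneg b₂) b₁) - tres (tmul σ b₁ (tneg b₂))
  rw [tres_tmul_eq_sum σ h₁' h₂', tres_tmul_eq_sum σ h₂' h₁', ← Finset.sum_sub_distrib] at hres
  rw [tres_tmul_eq_sum σ (tneg_eq_zero_of_lt h₁') h₂',
    tres_tmul_eq_sum σ h₂' (tneg_eq_zero_of_lt h₁'),
    tres_tmul_eq_sum σ (tneg_eq_zero_of_lt h₂') h₁',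
    tres_tmul_eq_sum σ h₁' (tneg_eq_zero_of_lt h₂'), ← sub_eq_zero, ← hres,
    ← Finset.sum_sub_distrib, ← Finset.sum_sub_distrib, ← Finset.sum_sub_distrib]
  refine Finset.sum_congr rfl fun i _ => ?_
  rcases lt_trichotomy i 0 with hi | rfl | hi
  · simp [tneg, hi, not_lt.2 hi.le]
  · simp [tneg, mul_comm]
  · simp [tneg, hi, not_lt.2 hi.le]
    ring
end

section
/- Let $R$ be a commutative $\mathbb{Q}$-algebra with ring automorphism $\sigma$, and let $L = \Lambda^N + u_{N-1}\Lambda^{N-1} + \cdots + u_{-M}\Lambda^{-M}$ with $N, M \ge 1$. In the ring of twisted series with support bounded above, the element $X := L\,\Lambda^{-N} - 1$ is supported in degrees $\le -1$; the series $\mathcal{W}_- := \sum_{k\ge 1} \frac{(-1)^{k+1}}{k} X^k$ is well defined (for each fixed degree only finitely many terms contribute, since $X^k$ is supported in degrees $\le -k$), is supported in degrees $\le -1$, and satisfies $e^{\mathcal{W}_-}\,\Lambda^N = L$, where $e^{\mathcal{W}_-} := \sum_{k\ge 0} \frac{1}{k!}\,\mathcal{W}_-^{\,k}$ (again degreewise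 a finite sum). -/
/-!
STATEMENT 14.  Let `R` be a commutative ℚ-algebra with ring automorphism `σ`, and
`L = Λ^N + u_{N-1}Λ^{N-1} + ⋯ + u_{-M}Λ^{-M}` with `N, M ≥ 1`.  Then
`X := L Λ^{-N} - 1` is supported in degrees `≤ -1`; the logarithm series
`𝒲₋ := ∑_{k ≥ 1} ((-1)^{k+1}/k) X^k` is well defined (degreewise only finitely many
terms contribute, since `X^k` is supported in degrees `≤ -k`), is supported in
degrees `≤ -1`, and satisfies `e^{𝒲₋} Λ^N = L`, where `e^{𝒲₋} = ∑_{k≥0} 𝒲₋^k/k!`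
(again degreewise a finite sum).
-/

open scoped BigOperators

open Toda

/-- `X = L Λ^{-N} - 1`. -/
noncomputable def Xser {R : Type*} [CommRing R] (σ : R ≃+* R) (L : ℤ → R) (N : ℕ) :
    ℤ → R :=
  tmul σ L (tunit (-(N : ℤ))) - tunit 0

/-- `𝒲₋ = ∑_{k ≥ 1} ((-1)^{k+1}/k) X^k`, degreewise a (finite) sum. -/
noncomputable def Wlog {R : Type*} [CommRing R] [Algebra ℚ R] (σ : R ≃+* R)
    (L : ℤ → R) (N : ℕ) : ℤ → R := fun d =>
  ∑ᶠ (k : ℕ) (_ : 1 ≤ k), ((-1 : ℚ) ^ (k + 1) / (k : ℚ)) • tnpow σ (Xser σ L N) k d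

/-- `e^{W} = ∑_{k ≥ 0} W^k / k!`, degreewise a (finite) sum. -/
noncomputable def texp {R : Type*} [CommRing R] [Algebra ℚ R] (σ : R ≃+* R)
    (W : ℤ → R) : ℤ → R := fun d =>
  ∑ᶠ (k : ℕ), ((1 : ℚ) / (Nat.factorial k : ℚ)) • tnpow σ W k d

namespace Polynomial

/-- The truncated exponential of the truncated series of `log (1 + X)` is `1 + X` up to the order
of truncation. -/
theorem X_pow_dvd_sum_sum_monomial_pow_sub (K : ℕ) :
    (X : ℚ[X]) ^ (K + 1) ∣
      ∑ k ∈ Finset.range (K + 1), C ((1 : ℚ) / (k.factorial : ℚ)) *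
        (∑ j ∈ Finset.range (K + 1), monomial j ((-1 : ℚ) ^ (j + 1) / (j : ℚ))) ^ k - (1 + X) := by
  set p : ℚ[X] := ∑ j ∈ Finset.range (K + 1), monomial j ((-1 : ℚ) ^ (j + 1) / (j : ℚ)) with hp
  set q : ℚ[X] := ∑ k ∈ Finset.range (K + 1), C ((1 : ℚ) / (k.factorial : ℚ)) * p ^ k with hq
  have hp0 : X ∣ p := by
    rw [X_dvd_iff, hp, finsetSum_coeff]
    refine Finset.sum_eq_zero fun j _ => ?_
    rcases Nat.eq_zero_or_pos j with rfl | hj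
    · simp
    · rw [coeff_monomial, if_neg hj.ne']
  have hdp : derivative p = ∑ j ∈ Finset.range K, (-X : ℚ[X]) ^ j := by
    rw [hp, Finset.sum_range_succ', derivative_add, derivative_sum]
    simp only [derivative_monomial, Nat.cast_zero, mul_zero, map_zero, add_zero]
    refine Finset.sum_congr rfl fun j _ => ?_
    have hj : ((j + 1 : ℕ) : ℚ) ≠ 0 := by positivity
    rw [div_mul_cancel₀ _ hj, neg_pow (X : ℚ[X]), ← C_mul_X_pow_eq_monomial]
    simp [pow_succ]
  have hgeom : (1 + X) * derivative p = 1 - (-X : ℚ[X]) ^ K := by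
    rw [hdp, ← mul_neg_geom_sum (-X : ℚ[X]) K, sub_neg_eq_add]
  have hdq : derivative q = (q - C ((1 : ℚ) / (K.factorial : ℚ)) * p ^ K) * derivative p := by
    rw [hq, Finset.sum_range_succ, add_sub_cancel_right, ← Finset.sum_range_succ,
      Finset.sum_range_succ', derivative_add, derivative_sum, Finset.sum_mul]
    simp only [pow_zero, mul_one, derivative_C, add_zero]
    refine Finset.sum_congr rfl fun k _ => ?_
    rw [derivative_C_mul, derivative_pow_succ, ← mul_assoc, ← mul_assoc]
    congr 2
    have hk : (k.factorial : ℚ) ≠ 0 := by positivity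
    have hk' : (k : ℚ) + 1 ≠ 0 := by positivity
    rw [← C_mul]
    congr 1
    rw [Nat.factorial_succ]
    push_cast
    field_simp
  have hode : X ^ K ∣ (1 + X) * derivative q - q := by
    have h1 : (1 + X) * derivative q - q = -((-X) ^ K * q)
        - (1 - (-X : ℚ[X]) ^ K) * (C ((1 : ℚ) / (K.factorial : ℚ)) * p ^ K) := by
      rw [← hgeom, hdq]
      linear_combination q * hgeom
    rw [h1]
    refine dvd_sub (dvd_neg.2 (Dvd.dvd.mul_right ?_ _))
      (Dvd.dvd.mul_left (Dvd.dvd.mul_left (pow_dvd_pow_of_dvd hp0 K) _) _)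
    exact pow_dvd_pow_of_dvd (dvd_neg.2 dvd_rfl) K
  have hrec : ∀ m < K, q.coeff (m + 1) * (m + 1) + q.coeff m * m = q.coeff m := by
    intro m hm
    have h := X_pow_dvd_iff.1 hode m hm
    rw [coeff_sub, add_mul, one_mul, coeff_add, coeff_derivative, sub_eq_zero] at h
    rcases m with _ | m
    · simpa using h
    · rw [coeff_X_mul, coeff_derivative] at h
      push_cast at h ⊢
      exact h
  have hq0 : q.coeff 0 = 1 := by
    have hp0' : p.coeff 0 = 0 := X_dvd_iff.1 hp0
    rw [hq, Finset.sum_range_succ', coeff_add, finsetSum_coeff, Finset.sum_eq_zero]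
    · simp
    · intro k _
      rw [coeff_C_mul, coeff_zero_eq_eval_zero, eval_pow, ← coeff_zero_eq_eval_zero, hp0']
      simp
  rw [X_pow_dvd_iff]
  intro m hm
  rw [coeff_sub, sub_eq_zero]
  induction m with
  | zero => simp [hq0]
  | succ m ih =>
    have h := hrec m (by omega)
    rw [ih (by omega)] at h
    have hm' : (m : ℚ) + 1 ≠ 0 := by positivity
    refine mul_right_cancel₀ hm' ?_
    rcases m with _ | _ | m <;> simpa [coeff_X, coeff_one] using h

end Polynomial

/-- The exponential of the logarithm of `1 + x`, for nilpotent `x`. -/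
theorem sum_sum_pow_eq_one_add_of_pow_eq_zero {A : Type*} [Ring A] [Algebra ℚ A] {x : A} {K : ℕ}
    (hx : x ^ (K + 1) = 0) :
    ∑ k ∈ Finset.range (K + 1), ((1 : ℚ) / (k.factorial : ℚ)) •
      (∑ j ∈ Finset.range (K + 1), ((-1 : ℚ) ^ (j + 1) / (j : ℚ)) • x ^ j) ^ k = 1 + x := by
  have h := map_dvd (Polynomial.aeval x) (Polynomial.X_pow_dvd_sum_sum_monomial_pow_sub K)
  rw [map_pow, Polynomial.aeval_X, hx, zero_dvd_iff] at h
  simpa [Polynomial.aeval_monomial, sub_eq_zero, Algebra.smul_def] using h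

namespace Toda

variable {R : Type*} [CommRing R] {σ : R ≃+* R} {a b : ℤ → R} {A B : ℤ}

theorem tmul_eq_zero (ha : ∀ d, A < d → a d = 0) (hb : ∀ d, B < d → b d = 0) {d : ℤ}
    (hd : A + B < d) : tmul σ a b d = 0 := by
  refine finsum_eq_zero_of_forall_eq_zero fun i => ?_
  rcases lt_or_ge A i with hi | hi
  · rw [ha i hi, zero_mul]
  · rw [hb _ (by omega), map_zero, mul_zero]

theorem tnpow_eq_zero (ha : ∀ d, -1 < d → a d = 0) (k : ℕ) {d : ℤ} (hd : -(k : ℤ) < d) :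
    tnpow σ a k d = 0 := by
  induction k generalizing d with
  | zero => exact if_neg (by push_cast at hd; omega)
  | succ k ih => exact tmul_eq_zero ha (fun _ => ih) (by push_cast at hd; omega)

theorem tmul_tunit (a : ℤ → R) (m d : ℤ) : tmul σ a (tunit m) d = a (d - m) := by
  rw [tmul, finsum_eq_single _ (d - m)]
  · simp [tunit]
  · intro i hi
    rw [tunit, if_neg (by omega), map_zero, mul_zero]

/-- The action of a twisted series on a window of `K + 1` consecutive degrees, as a matrix. It is
multiplicative on series supported in degrees `≤ 0`. -/
def windowMatrix (σ : R ≃+* R) (K : ℕ) (a : ℤ → R) : Matrix (Fin (K + 1)) (Fin (K + 1)) R :=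
  Matrix.of fun i j => (σ ^ (-(i : ℤ))) (a ((i : ℤ) - (j : ℤ)))

theorem windowMatrix_apply (K : ℕ) (a : ℤ → R) (i j : Fin (K + 1)) :
    windowMatrix σ K a i j = (σ ^ (-(i : ℤ))) (a ((i : ℤ) - (j : ℤ))) := rfl

theorem windowMatrix_tmul (K : ℕ) (ha : ∀ d, 0 < d → a d = 0) (hb : ∀ d, 0 < d → b d = 0) :
    windowMatrix σ K (tmul σ a b) = windowMatrix σ K a * windowMatrix σ K b := by
  ext i j
  have hinj : Function.Injective fun p : Fin (K + 1) => (i : ℤ) - (p : ℤ) := by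
    intro p q h
    ext
    simp only at h
    omega
  rw [Matrix.mul_apply, windowMatrix_apply, tmul,
    finsum_eq_sum_of_support_subset (s := Finset.univ.image fun p : Fin (K + 1) => (i : ℤ) - p),
    Finset.sum_image hinj.injOn, map_sum]
  · refine Finset.sum_congr rfl fun p _ => ?_
    rw [windowMatrix_apply, windowMatrix_apply, map_mul, ← RingAut.mul_apply, ← zpow_add]
    congr 3 <;> ring_nf
  · intro s hs
    rw [Function.mem_support] at hs
    have h1 : s ≤ 0 := by
      by_contra! h
      exact hs (by rw [ha s h, zero_mul])
    have h2 : (i : ℤ) - j - s ≤ 0 := by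
      by_contra! h
      exact hs (by rw [hb _ h, map_zero, mul_zero])
    rw [Finset.coe_image, Set.mem_image]
    exact ⟨⟨((i : ℤ) - s).toNat, by omega⟩, by simp, by simp; omega⟩

theorem windowMatrix_tunit_zero (K : ℕ) : windowMatrix σ K (tunit 0) = 1 := by
  ext i j
  rw [windowMatrix_apply, tunit, Matrix.one_apply]
  by_cases h : i = j
  · simp [h]
  · rw [if_neg h, if_neg (by omega), map_zero]

theorem windowMatrix_tnpow (K : ℕ) (ha : ∀ d, -1 < d → a d = 0) (k : ℕ) :
    windowMatrix σ K (tnpow σ a k) = windowMatrix σ K a ^ k := by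
  induction k with
  | zero => rw [pow_zero, tnpow, windowMatrix_tunit_zero]
  | succ k ih =>
    rw [tnpow, windowMatrix_tmul K (fun d hd => ha d (by omega))
      (fun d hd => tnpow_eq_zero ha k (by omega)), ih, pow_succ']

theorem windowMatrix_pow_eq_zero (K : ℕ) (ha : ∀ d, -1 < d → a d = 0) :
    windowMatrix σ K a ^ (K + 1) = 0 := by
  rw [← windowMatrix_tnpow K ha]
  ext i j
  rw [windowMatrix_apply, tnpow_eq_zero ha _ (by push_cast; omega), map_zero, Matrix.zero_apply]

theorem eq_of_windowMatrix_eq {K : ℕ} (h : windowMatrix σ K a = windowMatrix σ K b) :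
    a (-(K : ℤ)) = b (-(K : ℤ)) := by
  have h' := congrFun (congrFun h 0) (Fin.last K)
  simpa [windowMatrix_apply] using h'

theorem finsum_smul_tnpow_eq_sum [Algebra ℚ R] (ha : ∀ d, -1 < d → a d = 0) (c : ℕ → ℚ) {K : ℕ}
    {d : ℤ} (hd : -(K : ℤ) ≤ d) :
    ∑ᶠ k, c k • tnpow σ a k d = ∑ k ∈ Finset.range (K + 1), c k • tnpow σ a k d := by
  refine finsum_eq_sum_of_support_subset _ fun k hk => ?_
  rw [Finset.coe_range, Set.mem_Iio]
  by_contra! h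
  exact hk (by simp only; rw [tnpow_eq_zero ha k (by omega), smul_zero])

theorem windowMatrix_finsum_smul_tnpow [Algebra ℚ R] (K : ℕ) (ha : ∀ d, -1 < d → a d = 0)
    (c : ℕ → ℚ) :
    windowMatrix σ K (fun d => ∑ᶠ k, c k • tnpow σ a k d) =
      ∑ k ∈ Finset.range (K + 1), c k • windowMatrix σ K a ^ k := by
  ext i j
  rw [windowMatrix_apply, finsum_smul_tnpow_eq_sum ha c (K := K) (by omega), map_sum,
    Matrix.sum_apply]
  refine Finset.sum_congr rfl fun k _ => ?_
  rw [map_rat_smul, Matrix.smul_apply, ← windowMatrix_tnpow K ha, windowMatrix_apply]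

end Toda

theorem Xser_apply {R : Type*} [CommRing R] (σ : R ≃+* R) (L : ℤ → R) (N : ℕ) (d : ℤ) :
    Xser σ L N d = L (d + N) - tunit 0 d := by
  rw [Xser, Pi.sub_apply, tmul_tunit, sub_neg_eq_add]

/-- The coefficient of `X ^ 0` in the logarithm is a division by zero, hence `0`. -/
theorem Wlog_eq_finsum {R : Type*} [CommRing R] [Algebra ℚ R] (σ : R ≃+* R) (L : ℤ → R) (N : ℕ) :
    Wlog σ L N = fun d =>
      ∑ᶠ k : ℕ, ((-1 : ℚ) ^ (k + 1) / (k : ℚ)) • tnpow σ (Xser σ L N) k d := by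
  funext d
  refine finsum_congr fun k => ?_
  rcases Nat.eq_zero_or_pos k with rfl | hk
  · simp
  · exact finsum_eq_if.trans (if_pos hk)

theorem Wlog_eq_zero {R : Type*} [CommRing R] [Algebra ℚ R] {σ : R ≃+* R} {L : ℤ → R} {N : ℕ}
    (hX : ∀ d, -1 < d → Xser σ L N d = 0) {d : ℤ} (hd : -1 < d) : Wlog σ L N d = 0 := by
  rw [Wlog_eq_finsum]
  refine finsum_eq_zero_of_forall_eq_zero fun k => ?_
  rcases Nat.eq_zero_or_pos k with rfl | hk
  · simp
  · rw [tnpow_eq_zero hX k (by omega), smul_zero]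

theorem texp_Wlog {R : Type*} [CommRing R] [Algebra ℚ R] {σ : R ≃+* R} {L : ℤ → R} {N : ℕ}
    (hX : ∀ d, -1 < d → Xser σ L N d = 0) :
    texp σ (Wlog σ L N) = tunit 0 + Xser σ L N := by
  have hW : ∀ d, -1 < d → Wlog σ L N d = 0 := fun _ => Wlog_eq_zero hX
  funext d
  rcases lt_or_ge 0 d with hd | hd
  · rw [texp, finsum_eq_zero_of_forall_eq_zero fun k => by
      rw [tnpow_eq_zero hW k (by omega), smul_zero]]
    rw [Pi.add_apply, hX d (by omega), tunit, if_neg hd.ne', add_zero]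
  · obtain ⟨K, rfl⟩ : ∃ K : ℕ, d = -(K : ℤ) := ⟨d.natAbs, by omega⟩
    refine eq_of_windowMatrix_eq (σ := σ) ?_
    have hadd : windowMatrix σ K (tunit 0 + Xser σ L N) =
        windowMatrix σ K (tunit 0) + windowMatrix σ K (Xser σ L N) := by
      ext i j
      simp only [windowMatrix_apply, Matrix.add_apply, Pi.add_apply, map_add]
    have hlog := windowMatrix_finsum_smul_tnpow (σ := σ) K hX
      fun k => (-1 : ℚ) ^ (k + 1) / (k : ℚ)
    rw [← Wlog_eq_finsum] at hlog
    have hexp := windowMatrix_finsum_smul_tnpow (σ := σ) K hW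
      fun k => (1 : ℚ) / (k.factorial : ℚ)
    rw [hadd, windowMatrix_tunit_zero,
      ← sum_sum_pow_eq_one_add_of_pow_eq_zero (windowMatrix_pow_eq_zero K hX), ← hlog]
    exact hexp

/-- **The dressing logarithm**: `X = LΛ^{-N} - 1` is supported in degrees `≤ -1`,
each `X^k` in degrees `≤ -k` (so `𝒲₋ = ∑_{k≥1} ((-1)^{k+1}/k) X^k` is degreewise a
finite sum), `𝒲₋` is supported in degrees `≤ -1`, each `𝒲₋^k` in degrees `≤ -k`
(so `e^{𝒲₋}` is degreewise a finite sum), and `e^{𝒲₋} Λ^N = L`. -/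
theorem dressing_logarithm {R : Type*} [CommRing R] [Algebra ℚ R] (σ : R ≃+* R)
    (N M : ℕ) (hN : 1 ≤ N) (hM : 1 ≤ M) (L : ℤ → R)
    (hLtop : L (N : ℤ) = 1)
    (hLhigh : ∀ k : ℤ, (N : ℤ) < k → L k = 0)
    (hLlow : ∀ k : ℤ, k < -(M : ℤ) → L k = 0) :
    (∀ d : ℤ, -1 < d → Xser σ L N d = 0) ∧
    (∀ (d : ℤ) (k : ℕ), -d < (k : ℤ) → tnpow σ (Xser σ L N) k d = 0) ∧
    (∀ d : ℤ, -1 < d → Wlog σ L N d = 0) ∧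
    (∀ (d : ℤ) (k : ℕ), -d < (k : ℤ) → tnpow σ (Wlog σ L N) k d = 0) ∧
    tmul σ (texp σ (Wlog σ L N)) (tunit (N : ℤ)) = L := by
  have hX : ∀ d : ℤ, -1 < d → Xser σ L N d = 0 := by
    intro d hd
    rw [Xser_apply, tunit]
    rcases eq_or_ne d 0 with rfl | h0
    · simp [hLtop]
    · rw [hLhigh _ (by omega), if_neg h0, sub_zero]
  refine ⟨hX, fun d k hk => tnpow_eq_zero hX k (by omega), fun d => Wlog_eq_zero hX,
    fun d k hk => tnpow_eq_zero (fun _ => Wlog_eq_zero hX) k (by omega), ?_⟩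
  funext d
  rw [tmul_tunit, texp_Wlog hX, Pi.add_apply, Xser_apply, add_sub_cancel, sub_add_cancel]
end

section
/- Let $R$ be a commutative $\mathbb{Q}$-algebra with ring automorphism $\sigma$, fix $N, M \ge 1$, and let $L = \Lambda^N + u_{N-1}\Lambda^{N-1} + \cdots + u_{-M}\Lambda^{-M}$. Let $X$ be a twisted series with support bounded above satisfying $[L, X] = 0$. Then the second Hamiltonian operator applied to $X$ reduces to the first applied to $LX$: $P_2(X) := \tfrac12\,[L, (LX + XL)_-] - \tfrac12\, L\,[L,X]_{\le 0} - \tfrac12\,[L,X]_{\le 0}\, L \;=\; [L, (LX)_-] \;=\; [(LX)_+, L]_{\le 0} - [(LX)_-, L]_{>0} =: P_1(LX)$, where $(\cdot)_{\le 0}$ and $(\cdot)_{>0}$ denote the parts of degree $\le 0$ and $>0$; moreover the nonlocal correction term of $P_2$ vanishes since $\mathrm{res}\,[L,X] = 0$. (This identity yields the bihamiltonian recursion relation between the two Poisson brackets of the extended bigraded Toda hierarchy.) -/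
/-!
STATEMENT 19.  Let `R` be a commutative ℚ-algebra with ring automorphism `σ`, fix
`N, M ≥ 1` and `L = Λ^N + u_{N-1}Λ^{N-1} + ⋯ + u_{-M}Λ^{-M}`.  If `X` has support
bounded above and `[L,X] = 0`, then the second Hamiltonian operator applied to `X`
reduces to the first applied to `LX`:
`P₂(X) = ½[L,(LX+XL)₋] - ½L[L,X]_{≤0} - ½[L,X]_{≤0}L = [L,(LX)₋]
       = [(LX)₊,L]_{≤0} - [(LX)₋,L]_{>0} = P₁(LX)`,
and the nonlocal correction term of `P₂` vanishes since `res [L,X] = 0`.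
This yields the bihamiltonian recursion of the extended bigraded Toda hierarchy.
-/

open scoped BigOperators

open Toda

namespace Toda

section FiniteSupport

variable {R : Type*} [CommRing R] (σ : R ≃+* R) {F : Finset ℤ} {L : ℤ → R}

theorem tmul_left_apply (hL : ∀ k, k ∉ F → L k = 0) (b : ℤ → R) (k : ℤ) :
    tmul σ L b k = ∑ i ∈ F, L i * (σ ^ i) (b (k - i)) := by
  refine finsum_eq_sum_of_support_subset _ fun i hi => ?_
  by_contra h
  exact hi (by simp [hL i h])

theorem tmul_right_apply (hL : ∀ k, k ∉ F → L k = 0) (a : ℤ → R) (k : ℤ) :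
    tmul σ a L k = ∑ j ∈ F, a (k - j) * (σ ^ (k - j)) (L j) := by
  have h : tmul σ a L k = ∑ᶠ j : ℤ, a (k - j) * (σ ^ (k - j)) (L j) := by
    rw [tmul, ← finsum_comp_equiv (Equiv.subLeft k)]
    simp
  rw [h]
  refine finsum_eq_sum_of_support_subset _ fun j hj => ?_
  by_contra h
  exact hj (by simp [hL j h])

theorem tcomm_add (hL : ∀ k, k ∉ F → L k = 0) (a b : ℤ → R) :
    tcomm σ L (a + b) = tcomm σ L a + tcomm σ L b := by
  ext k
  simp only [tcomm, Pi.sub_apply, Pi.add_apply, tmul_left_apply σ hL, tmul_right_apply σ hL,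
    map_add, mul_add, add_mul, Finset.sum_add_distrib]
  ring

theorem tmul_tmul_self (hL : ∀ k, k ∉ F → L k = 0) (X : ℤ → R) :
    tmul σ (tmul σ L X) L = tmul σ L (tmul σ X L) := by
  ext k
  simp only [tmul_left_apply σ hL, tmul_right_apply σ hL, map_sum, Finset.mul_sum,
    Finset.sum_mul]
  rw [Finset.sum_comm]
  refine Finset.sum_congr rfl fun i _ => Finset.sum_congr rfl fun j _ => ?_
  rw [map_mul, ← RingAut.mul_apply, ← zpow_add, mul_assoc,
    show i + (k - i - j) = k - j by ring, show k - j - i = k - i - j by ring]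

end FiniteSupport

section Parts

variable {R : Type*} [CommRing R]

theorem tmul_zero (σ : R ≃+* R) (a : ℤ → R) : tmul σ a 0 = 0 := by
  ext k
  simp [tmul]

theorem zero_tmul (σ : R ≃+* R) (a : ℤ → R) : tmul σ 0 a = 0 := by
  ext k
  simp [tmul]

theorem tle0_zero : tle0 (0 : ℤ → R) = 0 := by
  ext k
  simp [tle0]

theorem tneg_add (a b : ℤ → R) : tneg (a + b) = tneg a + tneg b := by
  ext k
  by_cases h : k < 0 <;> simp [tneg, h]

theorem tle0_add_tgt0 (a : ℤ → R) : tle0 a + tgt0 a = a := by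
  ext k
  by_cases h : 0 < k
  · simp [tle0, tgt0, h, not_le.mpr h]
  · simp [tle0, tgt0, h, not_lt.mp h]

theorem tgt0_neg (a : ℤ → R) : tgt0 (-a) = -tgt0 a := by
  ext k
  by_cases h : 0 < k <;> simp [tgt0, h]

theorem tcomm_swap (σ : R ≃+* R) (a b : ℤ → R) : tcomm σ a b = -tcomm σ b a :=
  (neg_sub _ _).symm

end Parts

end Toda

/-- **Bihamiltonian recursion identity**: for `[L,X] = 0`, `res [L,X] = 0` and
`P₂(X) = [L,(LX)₋] = P₁(LX)`. -/
theorem second_hamiltonian_reduces {R : Type*} [CommRing R] [Algebra ℚ R]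
    (σ : R ≃+* R) (N M : ℕ) (hN : 1 ≤ N) (hM : 1 ≤ M) (L X : ℤ → R)
    (hLtop : L (N : ℤ) = 1)
    (hLhigh : ∀ k : ℤ, (N : ℤ) < k → L k = 0)
    (hLlow : ∀ k : ℤ, k < -(M : ℤ) → L k = 0)
    (hX : SuppBddAbove X)
    (hcomm : tcomm σ L X = 0) :
    tres (tcomm σ L X) = 0 ∧
    ((1/2 : ℚ) • tcomm σ L (tneg (tmul σ L X + tmul σ X L))
        - (1/2 : ℚ) • tmul σ L (tle0 (tcomm σ L X))
        - (1/2 : ℚ) • tmul σ (tle0 (tcomm σ L X)) L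
      = tcomm σ L (tneg (tmul σ L X))) ∧
    (tcomm σ L (tneg (tmul σ L X))
      = tle0 (tcomm σ (tpos (tmul σ L X)) L)
        - tgt0 (tcomm σ (tneg (tmul σ L X)) L)) := by
  have hL : ∀ k, k ∉ Finset.Icc (-(M : ℤ)) N → L k = 0 := by
    intro k hk
    rw [Finset.mem_Icc, not_and_or, not_le, not_le] at hk
    exact hk.elim (hLlow k) (hLhigh k)
  have hXL : tmul σ X L = tmul σ L X := (sub_eq_zero.mp hcomm).symm
  refine ⟨by rw [hcomm]; rfl, ?_, ?_⟩
  · rw [hcomm, hXL, tle0_zero, tmul_zero, zero_tmul, tneg_add, tcomm_add σ hL, smul_zero,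
      sub_zero, sub_zero, ← two_smul ℚ, smul_smul]
    norm_num
  · have hLY : tcomm σ L (tmul σ L X) = 0 := by
      rw [tcomm, tmul_tmul_self σ hL, hXL, sub_self]
    have hsplit : tcomm σ L (tneg (tmul σ L X)) = tcomm σ (tpos (tmul σ L X)) L := by
      rw [← tpos_add_tneg (tmul σ L X), tcomm_add σ hL] at hLY
      rw [tcomm_swap σ (tpos _), ← add_eq_zero_iff_eq_neg, add_comm, hLY]
    rw [← hsplit, tcomm_swap σ (tneg _), tgt0_neg, sub_neg_eq_add, tle0_add_tgt0]
end
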